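/- Let 𝒳 be a nonempty finite set, P_𝒳 a probability measure on 𝒳, P_ℱ a probability measure on the set of functions 𝒳 → {−1,1}, and let d ≥ 1, T ≥ 1, m ≥ 1, γ > 0, A > 0, σ > 0. For t = 0,…,T−1 let G_t : ℝ^d × (𝒳 × {−1,1}) → ℝ^d be measurable functions with every coordinate bounded in absolute value by γA. Fix w₀ ∈ ℝ^d. Given F ∼ P_ℱ, define the noisy descent iterates W_F^{(0)} = w₀ and W_F^{(t)} = W_F^{(t−1)} − (1/m)∑_{i=1}^m G_{t−1}(W_F^{(t−1)}, (X_i^{(t)}, F(X_i^{(t)}))) + Z^{(t)}, where the X_i^{(t)} are i.i.d. from P_𝒳 and Z^{(1)},…,Z^{(T)} are i.i.d. from N(0, σ²I_d), all independent. Define W_⋆^{(t)} by the same recursion with labels F(X_i^{(t)}) replaced by i.i.d. uniform signs Y_i^{(t)} ∈ {−1,1}. Then E_{F∼P_ℱ}[ d_TV( Law(W_F^{(T)} | F), Law(W_⋆^{(T)}) ) ] ≤ (γ A √d · T / σ) · (1/m + (1 − 1/m)·CP(P_𝒳, P_ℱ))^{1/4}. -/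

import Mathlib

open MeasureTheory Finset
open scoped ENNReal

/-- Cross-predictability of a distribution `pF` on sign-valued functions with respect to an
input distribution `pX` on a finite set `𝒳`. Signs are encoded as `ℤˣ = {±1}`. -/
noncomputable def cp {𝒳 : Type*} [Fintype 𝒳] [DecidableEq 𝒳] (pX : 𝒳 → ℝ)
    (pF : (𝒳 → ℤˣ) → ℝ) : ℝ :=
  ∑ F : 𝒳 → ℤˣ, ∑ F' : 𝒳 → ℤˣ, pF F * pF F' *
    (∑ x : 𝒳, pX x * (((F x : ℤ) : ℝ) * ((F' x : ℤ) : ℝ))) ^ 2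

/-- The centered isotropic Gaussian measure `N(0, vI_d)` on `ℝ^d` (variance `v`). -/
noncomputable def gaussPi (d : ℕ) (v : ℝ) : Measure (Fin d → ℝ) :=
  Measure.pi fun _ => ProbabilityTheory.gaussianReal 0 v.toNNReal

/-- Total variation distance between two measures on a measurable space. -/
noncomputable def tvDist {α : Type*} [MeasurableSpace α] (P Q : Measure α) : ℝ :=
  ⨆ s : {s : Set α // MeasurableSet s}, |(P s.1).toReal - (Q s.1).toReal|

/-- Law of the noisy batch-descent iterates: starting from `w₀`, step `t → t+1` draws an
i.i.d. batch `zs` of `m` labelled samples from the distribution with weights `q` on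
`𝒳 × {±1}`, subtracts the batch average of `G t`, and adds `N(0, σ²I_d)` noise. -/
noncomputable def iterLaw {𝒳 : Type*} [Fintype 𝒳] (d m : ℕ) (σ : ℝ)
    (G : ℕ → (Fin d → ℝ) → 𝒳 × ℤˣ → Fin d → ℝ)
    (q : 𝒳 × ℤˣ → ℝ) (w₀ : Fin d → ℝ) : ℕ → Measure (Fin d → ℝ)
  | 0 => Measure.dirac w₀
  | (t + 1) =>
      (iterLaw d m σ G q w₀ t).bind fun w =>
        ∑ zs : Fin m → 𝒳 × ℤˣ,
          ENNReal.ofReal (∏ i, q (zs i)) •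
            Measure.map (fun z j => w j - (1 / (m : ℝ)) * ∑ i, G t w (zs i) j + z j)
              (gaussPi d (σ ^ 2))

open ProbabilityTheory in
/-- The product of one-dimensional Gaussians has the product density. -/
lemma pi_gaussianReal_eq_withDensity {d : ℕ} (a : Fin d → ℝ) {v : NNReal} (hv : v ≠ 0) :
    Measure.pi (fun j => gaussianReal (a j) v) =
      volume.withDensity (fun z : Fin d → ℝ => ENNReal.ofReal (∏ j, gaussianPDFReal (a j) v (z j))) := by
  refine Measure.pi_eq fun s hs => ?_
  rw [withDensity_apply _ (MeasurableSet.univ_pi hs), volume_pi, Measure.restrict_pi_pi]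
  have hint : Integrable (fun z : Fin d → ℝ => ∏ j, gaussianPDFReal (a j) v (z j))
      (Measure.pi fun j => (volume : Measure ℝ).restrict (s j)) :=
    Integrable.fintype_prod fun j => (integrable_gaussianPDFReal _ _).integrableOn
  rw [← ofReal_integral_eq_lintegral_ofReal hint
    (.of_forall fun z => Finset.prod_nonneg fun j _ => gaussianPDFReal_nonneg _ _ _),
    integral_fintype_prod_eq_prod (fun j => gaussianPDFReal (a j) v),
    ENNReal.ofReal_prod_of_nonneg fun j _ => integral_nonneg fun x => gaussianPDFReal_nonneg _ _ _]
  simp_rw [gaussianReal_apply_eq_integral _ hv]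

open ProbabilityTheory in
lemma integral_pi_gaussianReal {d : ℕ} (a : Fin d → ℝ) {v : NNReal} (hv : v ≠ 0)
    (h : (Fin d → ℝ) → ℝ) :
    ∫ z, h z ∂Measure.pi (fun j => gaussianReal (a j) v) =
      ∫ z, (∏ j, gaussianPDFReal (a j) v (z j)) * h z := by
  rw [pi_gaussianReal_eq_withDensity a hv, integral_withDensity_eq_integral_toReal_smul]
  · refine integral_congr_ae (.of_forall fun z => ?_)
    simp only [smul_eq_mul]
    rw [ENNReal.toReal_ofReal (Finset.prod_nonneg fun j _ => gaussianPDFReal_nonneg _ _ _)]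
  · exact (Finset.measurable_prod _ fun j _ =>
      (measurable_gaussianPDFReal (a j) v).comp (measurable_pi_apply j)).ennreal_ofReal
  · exact .of_forall fun z => ENNReal.ofReal_lt_top

open ProbabilityTheory in
lemma map_add_gaussPi {d : ℕ} (a : Fin d → ℝ) (v : ℝ) :
    Measure.map (fun z j => a j + z j) (gaussPi d v) =
      Measure.pi (fun j => gaussianReal (a j) v.toNNReal) := by
  unfold gaussPi
  have := Measure.pi_map_pi (μ := fun _ : Fin d => gaussianReal 0 v.toNNReal)
    (f := fun j x => a j + x) (fun j => by fun_prop)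
  rw [this]
  simp_rw [gaussianReal_map_const_add, zero_add]

/-- A bound on the total variation distance of two densities in terms of their Hellinger
affinity. -/
lemma abs_integral_mul_sub_le_of_affinity {α : Type*} [MeasurableSpace α] {μ : Measure α}
    {f g s h : α → ℝ} {δ : ℝ} (hδ : 0 < δ)
    (hf : Integrable f μ) (hg : Integrable g μ) (hs : Integrable s μ)
    (hf0 : ∀ x, 0 ≤ f x) (hg0 : ∀ x, 0 ≤ g x)
    (hsq : ∀ x, s x ^ 2 = f x * g x)
    (hf1 : ∫ x, f x ∂μ = 1) (hg1 : ∫ x, g x ∂μ = 1)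
    (hs1 : 1 - δ ^ 2 / 8 ≤ ∫ x, s x ∂μ) (hs1' : ∫ x, s x ∂μ ≤ 1)
    (hm : Measurable h) (h0 : ∀ x, 0 ≤ h x) (h1 : ∀ x, h x ≤ 1) :
    |∫ x, f x * h x ∂μ - ∫ x, g x * h x ∂μ| ≤ δ / 2 := by
  have hb : ∀ x, ‖h x‖ ≤ 1 := fun x => by
    rw [Real.norm_eq_abs, abs_le]; constructor <;> linarith [h0 x, h1 x]
  have hfh : Integrable (fun x => f x * h x) μ := hf.mul_bdd hm.aestronglyMeasurable (.of_forall hb)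
  have hgh : Integrable (fun x => g x * h x) μ := hg.mul_bdd hm.aestronglyMeasurable (.of_forall hb)
  have e : ∫ x, f x * h x ∂μ - ∫ x, g x * h x ∂μ =
      ∫ x, (f x * h x - g x * h x - (1 / 2) * (f x - g x)) ∂μ := by
    have hd : Integrable (fun x => f x * h x - g x * h x) μ := hfh.sub hgh
    have hd' : Integrable (fun x => (1 / 2) * (f x - g x)) μ := (hf.sub hg).const_mul _
    rw [integral_sub hd hd', integral_sub hfh hgh, integral_const_mul, integral_sub hf hg,
      hf1, hg1]
    ring
  have hfg : Integrable (fun x => f x + g x) μ := hf.add hg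
  have hX : Integrable (fun x => (1 / δ) * (f x + g x - 2 * s x)) μ :=
    (hfg.sub (hs.const_mul 2)).const_mul _
  have hY : Integrable (fun x => (δ / 16) * (f x + g x + 2 * s x)) μ :=
    (hfg.add (hs.const_mul 2)).const_mul _
  have key : ∀ x, ‖f x * h x - g x * h x - (1 / 2) * (f x - g x)‖ ≤
      (1 / δ) * (f x + g x - 2 * s x) + (δ / 16) * (f x + g x + 2 * s x) := by
    intro x
    have hS : |s x| ≤ (f x + g x) / 2 := by
      apply abs_le_of_sq_le_sq _ (by linarith [hf0 x, hg0 x])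
      nlinarith [hsq x, sq_nonneg (f x - g x)]
    obtain ⟨hS1, hS2⟩ := abs_le.1 hS
    have hX : 0 ≤ (1 / δ) * (f x + g x - 2 * s x) := mul_nonneg (by positivity) (by linarith)
    have hY : 0 ≤ (δ / 16) * (f x + g x + 2 * s x) := mul_nonneg (by positivity) (by linarith)
    have hprod : ((1 / δ) * (f x + g x - 2 * s x)) * ((δ / 16) * (f x + g x + 2 * s x)) =
        (f x - g x) ^ 2 / 16 := by
      field_simp
      nlinarith [hsq x]
    have hfac : f x * h x - g x * h x - (1 / 2) * (f x - g x) = (h x - 1 / 2) * (f x - g x) := by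
      ring
    have hA : |(1 / 2) * (f x - g x)| ≤
        (1 / δ) * (f x + g x - 2 * s x) + (δ / 16) * (f x + g x + 2 * s x) := by
      apply abs_le_of_sq_le_sq _ (by linarith)
      nlinarith [sq_nonneg ((1 / δ) * (f x + g x - 2 * s x) - (δ / 16) * (f x + g x + 2 * s x))]
    rw [hfac, Real.norm_eq_abs]
    refine le_trans ?_ hA
    rw [abs_mul, abs_mul]
    refine mul_le_mul_of_nonneg_right ?_ (abs_nonneg _)
    rw [abs_of_pos (by norm_num : (0 : ℝ) < 1 / 2), abs_le]
    constructor <;> linarith [h0 x, h1 x]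
  rw [e, ← Real.norm_eq_abs]
  refine (norm_integral_le_of_norm_le (hX.add hY) (.of_forall key)).trans ?_
  change ∫ x, ((1 / δ) * (f x + g x - 2 * s x) + (δ / 16) * (f x + g x + 2 * s x)) ∂μ ≤ δ / 2
  have e2 : ∫ x, ((1 / δ) * (f x + g x - 2 * s x) + (δ / 16) * (f x + g x + 2 * s x)) ∂μ =
      (1 / δ) * (2 - 2 * ∫ x, s x ∂μ) + (δ / 16) * (2 + 2 * ∫ x, s x ∂μ) := by
    rw [integral_add hX hY, integral_const_mul, integral_const_mul,
      integral_sub hfg (hs.const_mul 2), integral_add hfg (hs.const_mul 2),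
      integral_add hf hg, integral_const_mul, hf1, hg1]
    ring
  rw [e2]
  have h3 : (1 / δ) * (2 - 2 * ∫ x, s x ∂μ) ≤ δ / 4 := by
    rw [one_div, inv_mul_le_iff₀ hδ]; nlinarith
  nlinarith

open ProbabilityTheory in
/-- Gaussian measures with the same covariance `vI_d` and means `a`, `b` differ by at most
`‖a - b‖ / (2√v)` on functions with values in `[0, 1]`. -/
lemma abs_integral_gaussian_sub_le {d : ℕ} (a b : Fin d → ℝ) {v : NNReal} (hv : v ≠ 0)
    {h : (Fin d → ℝ) → ℝ} (hm : Measurable h) (h0 : ∀ x, 0 ≤ h x) (h1 : ∀ x, h x ≤ 1) :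
    |∫ z, h z ∂Measure.pi (fun j => gaussianReal (a j) v) -
      ∫ z, h z ∂Measure.pi (fun j => gaussianReal (b j) v)| ≤
      √((∑ j, (a j - b j) ^ 2) / v) / 2 := by
  have hv0 : (0 : ℝ) < v := by positivity
  by_cases hab : a = b
  · subst hab
    simp
  have hpos : 0 < ∑ j, (a j - b j) ^ 2 := by
    obtain ⟨j, hj⟩ := Function.ne_iff.1 hab
    have : a j - b j ≠ 0 := sub_ne_zero.2 hj
    exact Finset.sum_pos' (fun i _ => sq_nonneg _) ⟨j, Finset.mem_univ _, by positivity⟩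
  set E : ℝ := Real.exp (-(∑ j, (a j - b j) ^ 2) / (8 * v)) with hE
  have hint : ∀ c : Fin d → ℝ, Integrable (fun z : Fin d → ℝ => ∏ j, gaussianPDFReal (c j) v (z j)) :=
    fun c => Integrable.fintype_prod fun j => integrable_gaussianPDFReal _ _
  have hone : ∀ c : Fin d → ℝ, ∫ z : Fin d → ℝ, ∏ j, gaussianPDFReal (c j) v (z j) = 1 := fun c => by
    rw [integral_fintype_prod_volume_eq_prod (fun j => gaussianPDFReal (c j) v)]
    exact Finset.prod_eq_one fun j _ => integral_gaussianPDFReal_eq_one _ hv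
  have hnn : ∀ (c z : Fin d → ℝ), 0 ≤ ∏ j, gaussianPDFReal (c j) v (z j) := fun c z =>
    Finset.prod_nonneg fun j _ => gaussianPDFReal_nonneg _ _ _
  rw [integral_pi_gaussianReal a hv, integral_pi_gaussianReal b hv]
  refine abs_integral_mul_sub_le_of_affinity
    (s := fun z => E * ∏ j, gaussianPDFReal ((a j + b j) / 2) v (z j))
    (by positivity) (hint a) (hint b) ((hint fun j => (a j + b j) / 2).const_mul _)
    (hnn a) (hnn b) ?_ (hone a) (hone b) ?_ ?_ hm h0 h1
  · intro z
    have hE2 : E ^ 2 = ∏ j, Real.exp (-(a j - b j) ^ 2 / (4 * v)) := by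
      rw [hE, ← Real.exp_nat_mul, ← Real.exp_sum, ← Finset.sum_div, Finset.sum_neg_distrib]
      congr 1
      field_simp
      norm_num
    rw [mul_pow, hE2, ← Finset.prod_pow, ← Finset.prod_mul_distrib, ← Finset.prod_mul_distrib]
    refine Finset.prod_congr rfl fun j _ => ?_
    simp only [gaussianPDFReal]
    rw [mul_pow, ← Real.exp_nat_mul, mul_mul_mul_comm, ← Real.exp_add, mul_left_comm,
      ← Real.exp_add, ← sq]
    congr 2
    field_simp
    push_cast
    ring
  · rw [integral_const_mul, hone fun j => (a j + b j) / 2, mul_one, Real.sq_sqrt (by positivity)]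
    refine le_trans (le_of_eq ?_) (Real.add_one_le_exp _)
    field_simp
    ring
  · rw [integral_const_mul, hone fun j => (a j + b j) / 2, mul_one, hE, Real.exp_le_one_iff]
    rw [neg_div]
    exact neg_nonpos.2 (by positivity)

lemma integral_bind_of_mem_Icc {α β : Type*} [MeasurableSpace α] [MeasurableSpace β]
    {μ : Measure α} [IsProbabilityMeasure μ] {k : α → Measure β} (hk : Measurable k)
    (hp : ∀ a, IsProbabilityMeasure (k a))
    {h : β → ℝ} (hm : Measurable h) (h0 : ∀ x, 0 ≤ h x) (h1 : ∀ x, h x ≤ 1) :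
    Measurable (fun a => ∫ x, h x ∂k a) ∧
      ∫ x, h x ∂(μ.bind k) = ∫ a, ∫ x, h x ∂k a ∂μ := by
  have e : ∀ ν : Measure β, ∫ x, h x ∂ν = (∫⁻ x, ENNReal.ofReal (h x) ∂ν).toReal := fun ν =>
    integral_eq_lintegral_of_nonneg_ae (.of_forall h0) hm.aestronglyMeasurable
  have hl : Measurable fun a => ∫⁻ x, ENNReal.ofReal (h x) ∂k a :=
    (Measure.measurable_lintegral hm.ennreal_ofReal).comp hk
  have hfin : ∀ a, ∫⁻ x, ENNReal.ofReal (h x) ∂k a ≤ 1 := fun a => by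
    have := hp a
    calc ∫⁻ x, ENNReal.ofReal (h x) ∂k a ≤ ∫⁻ _, 1 ∂k a :=
          lintegral_mono fun x => by simpa using h1 x
      _ = 1 := by simp
  simp_rw [e]
  refine ⟨hl.ennreal_toReal, ?_⟩
  rw [Measure.lintegral_bind hk.aemeasurable hm.ennreal_ofReal.aemeasurable]
  exact (integral_toReal hl.aemeasurable
    (.of_forall fun a => (hfin a).trans_lt ENNReal.one_lt_top)).symm

/-- The transition measure of one noisy descent step from `w`. -/
noncomputable def stepLaw {𝒳 : Type*} [Fintype 𝒳] (d m : ℕ) (σ : ℝ)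
    (g : (Fin d → ℝ) → 𝒳 × ℤˣ → Fin d → ℝ) (q : 𝒳 × ℤˣ → ℝ) (w : Fin d → ℝ) :
    Measure (Fin d → ℝ) :=
  ∑ zs : Fin m → 𝒳 × ℤˣ, ENNReal.ofReal (∏ i, q (zs i)) •
    Measure.map (fun z j => w j - (1 / (m : ℝ)) * ∑ i, g w (zs i) j + z j) (gaussPi d (σ ^ 2))

instance isProbabilityMeasure_gaussPi (d : ℕ) (v : ℝ) : IsProbabilityMeasure (gaussPi d v) := by
  unfold gaussPi; infer_instance

lemma measurable_stepLaw {𝒳 : Type*} [Fintype 𝒳] {d m : ℕ} {σ : ℝ}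
    {g : (Fin d → ℝ) → 𝒳 × ℤˣ → Fin d → ℝ} (hg : ∀ z, Measurable fun w => g w z)
    (q : 𝒳 × ℤˣ → ℝ) : Measurable (stepLaw d m σ g q) := by
  refine Measure.measurable_of_measurable_coe _ fun s hs => ?_
  simp only [stepLaw, Measure.coe_finsetSum, Finset.sum_apply, Measure.smul_apply, smul_eq_mul]
  refine Finset.measurable_sum _ fun zs _ => Measurable.const_mul ?_ _
  have hgj : ∀ z j, Measurable fun w => g w z j := fun z j => (measurable_pi_apply j).comp (hg z)
  have hF : Measurable fun p : (Fin d → ℝ) × (Fin d → ℝ) =>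
      fun j => p.1 j - (1 / (m : ℝ)) * ∑ i, g p.1 (zs i) j + p.2 j := by
    refine measurable_pi_lambda _ fun j => ?_
    have : ∀ i, Measurable fun p : (Fin d → ℝ) × (Fin d → ℝ) => g p.1 (zs i) j := fun i =>
      (hgj (zs i) j).comp measurable_fst
    fun_prop
  convert! measurable_measure_prodMk_left (ν := gaussPi d (σ ^ 2)) (hF hs) using 1
  funext w
  exact Measure.map_apply (hF.comp measurable_prodMk_left) hs

lemma sum_prod_weights {ι : Type*} [Fintype ι] {m : ℕ} {q : ι → ℝ} (hq1 : ∑ z, q z = 1) :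
    ∑ zs : Fin m → ι, ∏ i, q (zs i) = 1 := by
  rw [← Fintype.prod_sum fun (_ : Fin m) z => q z]
  simp [hq1]

lemma isProbabilityMeasure_stepLaw {𝒳 : Type*} [Fintype 𝒳] {d m : ℕ} {σ : ℝ}
    {g : (Fin d → ℝ) → 𝒳 × ℤˣ → Fin d → ℝ}
    {q : 𝒳 × ℤˣ → ℝ} (hq0 : ∀ z, 0 ≤ q z) (hq1 : ∑ z, q z = 1) (w : Fin d → ℝ) :
    IsProbabilityMeasure (stepLaw d m σ g q w) := by
  constructor
  simp only [stepLaw, Measure.coe_finsetSum, Finset.sum_apply, Measure.smul_apply, smul_eq_mul]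
  have : ∀ zs : Fin m → 𝒳 × ℤˣ, Measure.map
      (fun z j => w j - (1 / (m : ℝ)) * ∑ i, g w (zs i) j + z j) (gaussPi d (σ ^ 2)) Set.univ = 1 := by
    intro zs
    rw [Measure.map_apply (by fun_prop) MeasurableSet.univ]
    simp
  simp_rw [this, mul_one]
  rw [← ENNReal.ofReal_sum_of_nonneg fun zs _ => Finset.prod_nonneg fun i _ => hq0 _,
    sum_prod_weights hq1, ENNReal.ofReal_one]

open ProbabilityTheory in
lemma integral_stepLaw {𝒳 : Type*} [Fintype 𝒳] {d m : ℕ} {σ : ℝ}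
    {g : (Fin d → ℝ) → 𝒳 × ℤˣ → Fin d → ℝ}
    {q : 𝒳 × ℤˣ → ℝ} (hq0 : ∀ z, 0 ≤ q z) (w : Fin d → ℝ)
    {h : (Fin d → ℝ) → ℝ} (hm : Measurable h) (h0 : ∀ x, 0 ≤ h x) (h1 : ∀ x, h x ≤ 1) :
    ∫ x, h x ∂stepLaw d m σ g q w = ∑ zs : Fin m → 𝒳 × ℤˣ, (∏ i, q (zs i)) *
      ∫ x, h x ∂Measure.pi fun j =>
        gaussianReal (w j - (1 / (m : ℝ)) * ∑ i, g w (zs i) j) (σ ^ 2).toNNReal := by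
  have hb : ∀ x, ‖h x‖ ≤ 1 := fun x => by
    rw [Real.norm_eq_abs, abs_le]; constructor <;> linarith [h0 x, h1 x]
  unfold stepLaw
  simp_rw [map_add_gaussPi fun j => w j - (1 / (m : ℝ)) * ∑ i, g w (_ : 𝒳 × ℤˣ) j]
  rw [integral_finsetSum_measure]
  · refine Finset.sum_congr rfl fun zs _ => ?_
    rw [integral_smul_measure,
      ENNReal.toReal_ofReal (Finset.prod_nonneg fun i _ => hq0 _), smul_eq_mul]
  · intro zs _
    exact (Integrable.of_bound hm.aestronglyMeasurable 1 (.of_forall hb)).smul_measure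
      ENNReal.ofReal_ne_top

lemma sum_prod_weights_mul_prod {ι : Type*} [Fintype ι] {m : ℕ} (q : ι → ℝ) (f : Fin m → ι → ℝ) :
    ∑ zs : Fin m → ι, (∏ i, q (zs i)) * ∏ i, f i (zs i) = ∏ i, ∑ z, q z * f i z := by
  rw [Fintype.prod_sum fun i z => q z * f i z]
  simp_rw [Finset.prod_mul_distrib]

lemma sum_prod_weights_mul_apply {ι : Type*} [Fintype ι] {m : ℕ} {q : ι → ℝ}
    (hq1 : ∑ z, q z = 1) (φ : ι → ℝ) (k : Fin m) :
    ∑ zs : Fin m → ι, (∏ i, q (zs i)) * φ (zs k) = ∑ z, q z * φ z := by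
  have := sum_prod_weights_mul_prod q fun i z => if i = k then φ z else 1
  simp only [Finset.prod_ite_eq', Finset.mem_univ, if_true] at this
  rw [this, Finset.prod_eq_single k]
  · simp
  · intro i _ hi; simp [hi, hq1]
  · simp

lemma sum_prod_weights_mul_apply_mul_apply {ι : Type*} [Fintype ι] {m : ℕ} {q : ι → ℝ}
    (hq1 : ∑ z, q z = 1) (φ ψ : ι → ℝ) {k l : Fin m} (hkl : k ≠ l) :
    ∑ zs : Fin m → ι, (∏ i, q (zs i)) * (φ (zs k) * ψ (zs l)) =
      (∑ z, q z * φ z) * ∑ z, q z * ψ z := by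
  have := sum_prod_weights_mul_prod q fun i z =>
    (if i = k then φ z else 1) * (if i = l then ψ z else 1)
  simp only [Finset.prod_mul_distrib, Finset.prod_ite_eq', Finset.mem_univ, if_true] at this
  rw [this, ← Finset.mul_prod_erase _ _ (Finset.mem_univ k),
    ← Finset.mul_prod_erase _ _ (Finset.mem_erase.2 ⟨hkl.symm, Finset.mem_univ l⟩),
    Finset.prod_eq_one, mul_one]
  · simp [hkl, hkl.symm]
  · intro i hi
    simp only [Finset.mem_erase, Finset.mem_univ, and_true] at hi
    simp [hi.1, hi.2, hq1]

/-- The second moment of a sum of i.i.d. centered variables. -/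
lemma sum_prod_weights_mul_sum_sq {ι : Type*} [Fintype ι] {m : ℕ} {q e : ι → ℝ}
    (hq1 : ∑ z, q z = 1) (he : ∑ z, q z * e z = 0) :
    ∑ zs : Fin m → ι, (∏ i, q (zs i)) * (∑ i, e (zs i)) ^ 2 = m * ∑ z, q z * e z ^ 2 := by
  have h1 : ∀ zs : Fin m → ι, (∏ i, q (zs i)) * (∑ i, e (zs i)) ^ 2 =
      ∑ k, ∑ l, (∏ i, q (zs i)) * (e (zs k) * e (zs l)) := fun zs => by
    rw [sq, Finset.sum_mul_sum, Finset.mul_sum]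
    simp_rw [Finset.mul_sum]
  simp_rw [h1]
  rw [Finset.sum_comm]
  have h2 : ∀ k : Fin m, ∑ zs : Fin m → ι, ∑ l, (∏ i, q (zs i)) * (e (zs k) * e (zs l)) =
      ∑ z, q z * e z ^ 2 := fun k => by
    rw [Finset.sum_comm, Finset.sum_eq_single k]
    · rw [sum_prod_weights_mul_apply hq1 (fun z => e z * e z) k]
      simp_rw [sq]
    · intro l _ hl
      rw [sum_prod_weights_mul_apply_mul_apply hq1 e e hl.symm, he, zero_mul]
    · simp
  simp [h2]

lemma sum_mul_sub_sq {α : Type*} [Fintype α] {p u : α → ℝ} (hp : ∑ a, p a = 1)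
    (hu : ∑ a, p a * u a = 0) (x : ℝ) :
    ∑ a, p a * (x - u a) ^ 2 = x ^ 2 + ∑ a, p a * u a ^ 2 := by
  have : ∀ a, p a * (x - u a) ^ 2 = p a * x ^ 2 - 2 * x * (p a * u a) + p a * u a ^ 2 :=
    fun a => by ring
  simp_rw [this]
  rw [Finset.sum_add_distrib, Finset.sum_sub_distrib, ← Finset.sum_mul, ← Finset.mul_sum, hp, hu]
  ring

lemma sum_mul_batch_mean_sub {ι : Type*} [Fintype ι] {m : ℕ} (hm : 1 ≤ m) {q : ι → ℝ}
    (hq1 : ∑ z, q z = 1) (c : ι → ℝ) :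
    ∑ zs : Fin m → ι, (∏ i, q (zs i)) * ((1 / (m : ℝ)) * ∑ i, c (zs i) - ∑ z, q z * c z) = 0 := by
  have hm0 : (m : ℝ) ≠ 0 := by positivity
  simp_rw [mul_sub]
  rw [Finset.sum_sub_distrib, ← Finset.sum_mul, sum_prod_weights hq1]
  simp_rw [mul_left_comm _ (1 / (m : ℝ)), ← Finset.mul_sum, Finset.mul_sum univ (fun i => c _)]
  rw [Finset.sum_comm]
  simp_rw [sum_prod_weights_mul_apply hq1 c]
  simp
  field_simp
  simp

lemma sum_mul_batch_mean_sub_sq_le {ι : Type*} [Fintype ι] {m : ℕ} (hm : 1 ≤ m) {q : ι → ℝ}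
    (hq0 : ∀ z, 0 ≤ q z) (hq1 : ∑ z, q z = 1) {c : ι → ℝ} {B : ℝ} (hc : ∀ z, |c z| ≤ B) :
    ∑ zs : Fin m → ι, (∏ i, q (zs i)) * ((1 / (m : ℝ)) * ∑ i, c (zs i) - ∑ z, q z * c z) ^ 2 ≤
      B ^ 2 / m := by
  have hm0 : (0 : ℝ) < m := by positivity
  set μ := ∑ z, q z * c z with hμ
  have he : ∑ z, q z * (c z - μ) = 0 := by
    simp_rw [mul_sub]
    rw [Finset.sum_sub_distrib, ← Finset.sum_mul, hq1]
    linarith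
  have h1 : ∀ zs : Fin m → ι, (∏ i, q (zs i)) * ((1 / (m : ℝ)) * ∑ i, c (zs i) - μ) ^ 2 =
      (1 / (m : ℝ)) ^ 2 * ((∏ i, q (zs i)) * (∑ i, (c (zs i) - μ)) ^ 2) := fun zs => by
    rw [Finset.sum_sub_distrib]
    simp only [Finset.sum_const, Finset.card_univ, Fintype.card_fin, nsmul_eq_mul]
    field_simp
  simp_rw [h1]
  rw [← Finset.mul_sum, sum_prod_weights_mul_sum_sq hq1 (e := fun z => c z - μ) he]
  have h2 : ∑ z, q z * (c z - μ) ^ 2 ≤ B ^ 2 := by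
    have h3 : ∑ z, q z * c z ^ 2 = μ ^ 2 + ∑ z, q z * (c z - μ) ^ 2 := by
      have := sum_mul_sub_sq hq1 he (-μ)
      rw [neg_sq] at this
      rw [← this]
      exact Finset.sum_congr rfl fun z _ => by ring
    have h4 : ∑ z, q z * c z ^ 2 ≤ ∑ z, q z * B ^ 2 :=
      Finset.sum_le_sum fun z _ => mul_le_mul_of_nonneg_left
        (sq_le_sq' (abs_le.1 (hc z)).1 (abs_le.1 (hc z)).2) (hq0 z)
    rw [← Finset.sum_mul, hq1] at h4
    nlinarith [sq_nonneg μ]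
  calc (1 / (m : ℝ)) ^ 2 * (m * ∑ z, q z * (c z - μ) ^ 2)
      = (∑ z, q z * (c z - μ) ^ 2) / m := by field_simp
    _ ≤ B ^ 2 / m := by gcongr

/-- The mean squared distance of two independent batch averages. -/
lemma sum_mul_batch_mean_diff_sq_le {ι : Type*} [Fintype ι] {m : ℕ} (hm : 1 ≤ m) {q q' : ι → ℝ}
    (hq0 : ∀ z, 0 ≤ q z) (hq1 : ∑ z, q z = 1) (hq0' : ∀ z, 0 ≤ q' z) (hq1' : ∑ z, q' z = 1)
    {c : ι → ℝ} {B : ℝ} (hc : ∀ z, |c z| ≤ B) :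
    ∑ zs : Fin m → ι, (∏ i, q (zs i)) * ∑ zs' : Fin m → ι, (∏ i, q' (zs' i)) *
        ((1 / (m : ℝ)) * ∑ i, c (zs i) - (1 / (m : ℝ)) * ∑ i, c (zs' i)) ^ 2 ≤
      (∑ z, q z * c z - ∑ z, q' z * c z) ^ 2 + 2 * B ^ 2 / m := by
  set μ := ∑ z, q z * c z with hμ
  set μ' := ∑ z, q' z * c z with hμ'
  have inner : ∀ x : ℝ, ∑ zs' : Fin m → ι, (∏ i, q' (zs' i)) *
      (x - (1 / (m : ℝ)) * ∑ i, c (zs' i)) ^ 2 = (x - μ') ^ 2 + ∑ zs' : Fin m → ι,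
        (∏ i, q' (zs' i)) * ((1 / (m : ℝ)) * ∑ i, c (zs' i) - μ') ^ 2 := fun x => by
    rw [← sum_mul_sub_sq (sum_prod_weights hq1') (sum_mul_batch_mean_sub hm hq1' c)]
    exact Finset.sum_congr rfl fun z _ => by ring
  have outer : ∑ zs : Fin m → ι, (∏ i, q (zs i)) * ((1 / (m : ℝ)) * ∑ i, c (zs i) - μ') ^ 2 =
      (μ - μ') ^ 2 + ∑ zs : Fin m → ι,
        (∏ i, q (zs i)) * ((1 / (m : ℝ)) * ∑ i, c (zs i) - μ) ^ 2 := by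
    rw [← neg_sub μ' μ, neg_sq,
      ← sum_mul_sub_sq (sum_prod_weights hq1) (sum_mul_batch_mean_sub hm hq1 c)]
    exact Finset.sum_congr rfl fun z _ => by ring
  simp_rw [inner, mul_add]
  rw [Finset.sum_add_distrib, outer, ← Finset.sum_mul, sum_prod_weights hq1, one_mul]
  have h1 := sum_mul_batch_mean_sub_sq_le hm hq0 hq1 hc
  have h2 := sum_mul_batch_mean_sub_sq_le hm hq0' hq1' hc
  have h3 : 2 * B ^ 2 / m = B ^ 2 / m + B ^ 2 / m := by ring
  linarith

lemma sum_mul_sqrt_le {α : Type*} [Fintype α] {p D : α → ℝ} (hp0 : ∀ a, 0 ≤ p a)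
    (hp1 : ∑ a, p a = 1) (hD : ∀ a, 0 ≤ D a) :
    ∑ a, p a * √(D a) ≤ √(∑ a, p a * D a) := by
  apply Real.le_sqrt_of_sq_le
  have := Finset.sum_sq_le_sum_mul_sum_of_sq_le_mul univ (r := fun a => p a * √(D a))
    (f := p) (g := fun a => p a * D a) (fun a _ => hp0 a)
    (fun a _ => mul_nonneg (hp0 a) (hD a)) fun a _ => by
      rw [mul_pow, Real.sq_sqrt (hD a)]
      exact le_of_eq (by ring)
  rwa [hp1, one_mul] at this

lemma sum_sum_mul_sqrt_sum_div_le {α β κ : Type*} [Fintype α] [Fintype β] [Fintype κ]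
    {p : α → ℝ} {p' : β → ℝ} (hp0 : ∀ a, 0 ≤ p a) (hp1 : ∑ a, p a = 1)
    (hp0' : ∀ b, 0 ≤ p' b) (hp1' : ∑ b, p' b = 1)
    {D : α → β → κ → ℝ} (hD : ∀ a b j, 0 ≤ D a b j) {s : ℝ} (hs : 0 ≤ s) :
    ∑ a, p a * ∑ b, p' b * (√((∑ j, D a b j) / s) / 2) ≤
      √((∑ j, ∑ a, p a * ∑ b, p' b * D a b j) / s) / 2 := by
  have hD0 : ∀ a b, 0 ≤ (∑ j, D a b j) / s := fun a b =>
    div_nonneg (Finset.sum_nonneg fun j _ => hD a b j) hs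
  calc ∑ a, p a * ∑ b, p' b * (√((∑ j, D a b j) / s) / 2)
      = (∑ a, p a * ∑ b, p' b * √((∑ j, D a b j) / s)) / 2 := by
        simp_rw [← mul_div_assoc, ← Finset.sum_div, ← mul_div_assoc, ← Finset.sum_div]
    _ ≤ (∑ a, p a * √(∑ b, p' b * ((∑ j, D a b j) / s))) / 2 := by
        gcongr with a _
        · exact hp0 a
        · exact sum_mul_sqrt_le hp0' hp1' (hD0 a)
    _ ≤ √(∑ a, p a * ∑ b, p' b * ((∑ j, D a b j) / s)) / 2 := by
        gcongr
        exact sum_mul_sqrt_le hp0 hp1 fun a =>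
          Finset.sum_nonneg fun b _ => mul_nonneg (hp0' b) (hD0 a b)
    _ = √((∑ j, ∑ a, p a * ∑ b, p' b * D a b j) / s) / 2 := by
        congr 2
        simp_rw [← mul_div_assoc, ← Finset.sum_div, ← mul_div_assoc, ← Finset.sum_div,
          Finset.mul_sum]
        congr 1
        symm
        rw [Finset.sum_comm]
        exact Finset.sum_congr rfl fun a _ => Finset.sum_comm

lemma sum_label_weights_mul {𝒳 : Type*} [Fintype 𝒳] (pX : 𝒳 → ℝ) (F : 𝒳 → ℤˣ) (c : 𝒳 × ℤˣ → ℝ) :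
    ∑ z : 𝒳 × ℤˣ, (pX z.1 * if z.2 = F z.1 then 1 else 0) * c z = ∑ x, pX x * c (x, F x) := by
  rw [Fintype.sum_prod_type]
  refine Finset.sum_congr rfl fun x _ => ?_
  rw [Finset.sum_eq_single (F x)]
  · simp
  · intro y _ hy; simp [hy]
  · exact fun h => absurd (Finset.mem_univ _) h

lemma sum_junk_weights_mul {𝒳 : Type*} [Fintype 𝒳] (pX : 𝒳 → ℝ) (c : 𝒳 × ℤˣ → ℝ) :
    ∑ z : 𝒳 × ℤˣ, (pX z.1 * (1 / 2)) * c z = ∑ x, pX x * ((c (x, 1) + c (x, -1)) / 2) := by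
  rw [Fintype.sum_prod_type]
  refine Finset.sum_congr rfl fun x _ => ?_
  rw [UnitsInt.univ, Finset.sum_pair (by decide)]
  ring

section CrossPredictability

variable {𝒳 : Type*} [Fintype 𝒳] [DecidableEq 𝒳] {pX : 𝒳 → ℝ} {pF : (𝒳 → ℤˣ) → ℝ}

lemma cp_eq_sum_correlation_sq (pX : 𝒳 → ℝ) (pF : (𝒳 → ℤˣ) → ℝ) :
    cp pX pF = ∑ x, pX x * ∑ y, pX y *
      (∑ F : 𝒳 → ℤˣ, pF F * (((F x : ℤ) : ℝ) * ((F y : ℤ) : ℝ))) ^ 2 := by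
  unfold cp
  simp_rw [sq, Finset.sum_mul_sum, Finset.mul_sum]
  have swap : ∀ f : (𝒳 → ℤˣ) → (𝒳 → ℤˣ) → 𝒳 → 𝒳 → ℝ,
      ∑ F, ∑ F', ∑ x, ∑ y, f F F' x y = ∑ x, ∑ y, ∑ F, ∑ F', f F F' x y := fun f => by
    calc ∑ F, ∑ F', ∑ x, ∑ y, f F F' x y = ∑ F, ∑ x, ∑ F', ∑ y, f F F' x y :=
          Finset.sum_congr rfl fun _ _ => Finset.sum_comm
      _ = ∑ x, ∑ F, ∑ F', ∑ y, f F F' x y := Finset.sum_comm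
      _ = ∑ x, ∑ F, ∑ y, ∑ F', f F F' x y :=
          Finset.sum_congr rfl fun _ _ => Finset.sum_congr rfl fun _ _ => Finset.sum_comm
      _ = _ := Finset.sum_congr rfl fun _ _ => Finset.sum_comm
  rw [swap]
  refine Finset.sum_congr rfl fun x _ => Finset.sum_congr rfl fun y _ =>
    Finset.sum_congr rfl fun F _ => Finset.sum_congr rfl fun F' _ => ?_
  ring

lemma abs_units_int_cast (u : ℤˣ) : |((u : ℤ) : ℝ)| = 1 := by
  rcases Int.units_eq_one_or u with h | h <;> simp [h]

lemma cp_nonneg (hpX0 : ∀ x, 0 ≤ pX x) : 0 ≤ cp pX pF := by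
  rw [cp_eq_sum_correlation_sq]
  exact Finset.sum_nonneg fun x _ => mul_nonneg (hpX0 x) <| Finset.sum_nonneg fun y _ =>
    mul_nonneg (hpX0 y) (sq_nonneg _)

lemma cp_le_one (hpX0 : ∀ x, 0 ≤ pX x) (hpX1 : ∑ x, pX x = 1)
    (hpF0 : ∀ F, 0 ≤ pF F) (hpF1 : ∑ F, pF F = 1) : cp pX pF ≤ 1 := by
  have hc : ∀ x y, (∑ F : 𝒳 → ℤˣ, pF F * (((F x : ℤ) : ℝ) * ((F y : ℤ) : ℝ))) ^ 2 ≤ 1 := by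
    intro x y
    rw [sq_le_one_iff_abs_le_one, ← hpF1]
    refine (Finset.abs_sum_le_sum_abs _ _).trans (Finset.sum_le_sum fun F _ => ?_)
    rw [abs_mul, abs_mul, abs_units_int_cast, abs_units_int_cast, abs_of_nonneg (hpF0 F)]
    simp
  rw [cp_eq_sum_correlation_sq]
  calc _ ≤ ∑ x, pX x * ∑ y, pX y * 1 := by
        gcongr with x _ y _
        · exact hpX0 x
        · exact hpX0 y
        · exact hc x y
    _ = 1 := by simp [hpX1]

lemma sum_mul_correlation_sq_le (hpX0 : ∀ x, 0 ≤ pX x) (hpX1 : ∑ x, pX x = 1)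
    {r : 𝒳 → ℝ} {B : ℝ} (hr : ∀ x, |r x| ≤ B) :
    ∑ F, pF F * (∑ x, pX x * (((F x : ℤ) : ℝ) * r x)) ^ 2 ≤ B ^ 2 * √(cp pX pF) := by
  set c : 𝒳 → 𝒳 → ℝ := fun x y => ∑ F : 𝒳 → ℤˣ, pF F * (((F x : ℤ) : ℝ) * ((F y : ℤ) : ℝ))
    with hc
  have e : ∑ F, pF F * (∑ x, pX x * (((F x : ℤ) : ℝ) * r x)) ^ 2 =
      ∑ x, pX x * ∑ y, pX y * (r x * r y * c x y) := by
    simp_rw [hc, sq, Finset.sum_mul_sum, Finset.mul_sum]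
    rw [Finset.sum_comm]
    refine Finset.sum_congr rfl fun x _ => ?_
    rw [Finset.sum_comm]
    refine Finset.sum_congr rfl fun y _ => Finset.sum_congr rfl fun F _ => ?_
    ring
  have hb : ∀ x y, r x * r y * c x y ≤ B ^ 2 * √(c x y ^ 2) := fun x y => by
    rw [Real.sqrt_sq_eq_abs]
    refine (le_abs_self _).trans ?_
    rw [abs_mul, abs_mul, sq]
    have := (abs_nonneg (r x)).trans (hr x)
    gcongr <;> exact hr _
  rw [e]
  calc ∑ x, pX x * ∑ y, pX y * (r x * r y * c x y)
      ≤ ∑ x, pX x * ∑ y, pX y * (B ^ 2 * √(c x y ^ 2)) := by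
        exact Finset.sum_le_sum fun x _ => mul_le_mul_of_nonneg_left (Finset.sum_le_sum fun y _ =>
          mul_le_mul_of_nonneg_left (hb x y) (hpX0 y)) (hpX0 x)
    _ = B ^ 2 * ∑ x, pX x * ∑ y, pX y * √(c x y ^ 2) := by
        simp_rw [mul_left_comm _ (B ^ 2), ← Finset.mul_sum, mul_left_comm _ (B ^ 2),
          ← Finset.mul_sum]
    _ ≤ B ^ 2 * ∑ x, pX x * √(∑ y, pX y * c x y ^ 2) := by
        gcongr with x _
        · exact hpX0 x
        · exact sum_mul_sqrt_le hpX0 hpX1 fun y => sq_nonneg _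
    _ ≤ B ^ 2 * √(∑ x, pX x * ∑ y, pX y * c x y ^ 2) := by
        gcongr
        exact sum_mul_sqrt_le hpX0 hpX1 fun x =>
          Finset.sum_nonneg fun y _ => mul_nonneg (hpX0 y) (sq_nonneg _)
    _ = B ^ 2 * √(cp pX pF) := by rw [cp_eq_sum_correlation_sq]

lemma sum_mul_label_mean_sub_junk_mean_sq_le (hpX0 : ∀ x, 0 ≤ pX x) (hpX1 : ∑ x, pX x = 1)
    {c : 𝒳 × ℤˣ → ℝ} {B : ℝ} (hc : ∀ z, |c z| ≤ B) :
    ∑ F, pF F * (∑ z : 𝒳 × ℤˣ, (pX z.1 * if z.2 = F z.1 then 1 else 0) * c z -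
      ∑ z : 𝒳 × ℤˣ, (pX z.1 * (1 / 2)) * c z) ^ 2 ≤ B ^ 2 * √(cp pX pF) := by
  have hr : ∀ x, |(c (x, 1) - c (x, -1)) / 2| ≤ B := fun x => by
    have h1 := abs_le.1 (hc (x, 1))
    have h2 := abs_le.1 (hc (x, -1))
    rw [abs_le]; constructor <;> linarith
  refine le_trans (le_of_eq ?_) (sum_mul_correlation_sq_le (pF := pF) hpX0 hpX1 hr)
  refine Finset.sum_congr rfl fun F _ => ?_
  rw [sum_label_weights_mul, sum_junk_weights_mul, ← Finset.sum_sub_distrib]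
  congr 2
  refine Finset.sum_congr rfl fun x _ => ?_
  rcases Int.units_eq_one_or (F x) with h | h <;> rw [h] <;> push_cast <;> ring

end CrossPredictability

/-- The expected distance, over independent batches from `q` and `q'`, of the two batch averages
of `g w`, in units of `2σ`. -/
noncomputable def stepGap {𝒳 : Type*} [Fintype 𝒳] (d m : ℕ) (σ : ℝ)
    (g : (Fin d → ℝ) → 𝒳 × ℤˣ → Fin d → ℝ) (q q' : 𝒳 × ℤˣ → ℝ) (w : Fin d → ℝ) : ℝ :=
  ∑ zs : Fin m → 𝒳 × ℤˣ, (∏ i, q (zs i)) * ∑ zs' : Fin m → 𝒳 × ℤˣ, (∏ i, q' (zs' i)) *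
    (√((∑ j, ((1 / (m : ℝ)) * ∑ i, g w (zs i) j - (1 / (m : ℝ)) * ∑ i, g w (zs' i) j) ^ 2) /
      σ ^ 2) / 2)

section Step

variable {𝒳 : Type*} [Fintype 𝒳] {d m : ℕ} {σ : ℝ}
  {g : (Fin d → ℝ) → 𝒳 × ℤˣ → Fin d → ℝ} {q q' : 𝒳 × ℤˣ → ℝ}

lemma measurable_stepGap (hg : ∀ z, Measurable fun w => g w z) :
    Measurable (stepGap d m σ g q q') := by
  have hgj : ∀ z j, Measurable fun w => g w z j := fun z j => (measurable_pi_apply j).comp (hg z)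
  unfold stepGap
  fun_prop

lemma stepGap_nonneg (hq0 : ∀ z, 0 ≤ q z) (hq0' : ∀ z, 0 ≤ q' z) (w : Fin d → ℝ) :
    0 ≤ stepGap d m σ g q q' w :=
  Finset.sum_nonneg fun _ _ => mul_nonneg (Finset.prod_nonneg fun _ _ => hq0 _) <|
    Finset.sum_nonneg fun _ _ => mul_nonneg (Finset.prod_nonneg fun _ _ => hq0' _) (by positivity)

/-- The expected gap is bounded by the coordinatewise differences of the means. -/
lemma stepGap_le (hm : 1 ≤ m) (hq0 : ∀ z, 0 ≤ q z) (hq1 : ∑ z, q z = 1)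
    (hq0' : ∀ z, 0 ≤ q' z) (hq1' : ∑ z, q' z = 1) {B : ℝ} {w : Fin d → ℝ}
    (hB : ∀ z j, |g w z j| ≤ B) :
    stepGap d m σ g q q' w ≤ √((∑ j, ((∑ z, q z * g w z j - ∑ z, q' z * g w z j) ^ 2 +
      2 * B ^ 2 / m)) / σ ^ 2) / 2 := by
  have key := sum_sum_mul_sqrt_sum_div_le
    (p := fun zs : Fin m → 𝒳 × ℤˣ => ∏ i, q (zs i))
    (p' := fun zs : Fin m → 𝒳 × ℤˣ => ∏ i, q' (zs i))
    (D := fun zs zs' (j : Fin d) =>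
      ((1 / (m : ℝ)) * ∑ i, g w (zs i) j - (1 / (m : ℝ)) * ∑ i, g w (zs' i) j) ^ 2)
    (fun zs => Finset.prod_nonneg fun i _ => hq0 (zs i)) (sum_prod_weights hq1)
    (fun zs => Finset.prod_nonneg fun i _ => hq0' (zs i)) (sum_prod_weights hq1')
    (fun _ _ _ => sq_nonneg _) (sq_nonneg σ)
  unfold stepGap
  refine key.trans ?_
  refine div_le_div_of_nonneg_right (Real.sqrt_le_sqrt ?_) zero_le_two
  refine div_le_div_of_nonneg_right (Finset.sum_le_sum fun j _ => ?_) (sq_nonneg σ)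
  exact sum_mul_batch_mean_diff_sq_le hm hq0 hq1 hq0' hq1' (c := fun z => g w z j) fun z => hB z j

lemma abs_integral_stepLaw_sub_le (hσ : 0 < σ) (hq0 : ∀ z, 0 ≤ q z) (hq1 : ∑ z, q z = 1)
    (hq0' : ∀ z, 0 ≤ q' z) (hq1' : ∑ z, q' z = 1) (w : Fin d → ℝ)
    {h : (Fin d → ℝ) → ℝ} (hh : Measurable h) (h0 : ∀ x, 0 ≤ h x) (h1 : ∀ x, h x ≤ 1) :
    |∫ x, h x ∂stepLaw d m σ g q w - ∫ x, h x ∂stepLaw d m σ g q' w| ≤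
      stepGap d m σ g q q' w := by
  have hv : (σ ^ 2).toNNReal ≠ 0 := by simpa using hσ.ne'
  rw [integral_stepLaw hq0 w hh h0 h1, integral_stepLaw hq0' w hh h0 h1]
  set I : (Fin m → 𝒳 × ℤˣ) → ℝ := fun zs => ∫ x, h x ∂Measure.pi fun j =>
    ProbabilityTheory.gaussianReal (w j - (1 / (m : ℝ)) * ∑ i, g w (zs i) j) (σ ^ 2).toNNReal
    with hI
  have e : ∑ zs : Fin m → 𝒳 × ℤˣ, (∏ i, q (zs i)) * I zs -
      ∑ zs : Fin m → 𝒳 × ℤˣ, (∏ i, q' (zs i)) * I zs =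
      ∑ zs : Fin m → 𝒳 × ℤˣ, (∏ i, q (zs i)) * ∑ zs' : Fin m → 𝒳 × ℤˣ, (∏ i, q' (zs' i)) *
        (I zs - I zs') := by
    simp_rw [mul_sub, Finset.sum_sub_distrib, ← Finset.sum_mul, sum_prod_weights hq1', one_mul,
      mul_sub, Finset.sum_sub_distrib, ← Finset.sum_mul, sum_prod_weights hq1, one_mul]
  rw [e]
  refine (Finset.abs_sum_le_sum_abs _ _).trans (Finset.sum_le_sum fun zs _ => ?_)
  have hQ : 0 ≤ ∏ i, q (zs i) := Finset.prod_nonneg fun _ _ => hq0 _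
  rw [abs_mul, abs_of_nonneg hQ]
  refine mul_le_mul_of_nonneg_left ?_ hQ
  refine (Finset.abs_sum_le_sum_abs _ _).trans (Finset.sum_le_sum fun zs' _ => ?_)
  have hQ' : 0 ≤ ∏ i, q' (zs' i) := Finset.prod_nonneg fun _ _ => hq0' _
  rw [abs_mul, abs_of_nonneg hQ']
  refine mul_le_mul_of_nonneg_left ?_ hQ'
  refine (abs_integral_gaussian_sub_le _ _ hv hh h0 h1).trans (le_of_eq ?_)
  rw [Real.coe_toNNReal _ (sq_nonneg σ)]
  congr 3
  exact Finset.sum_congr rfl fun j _ => by ring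

lemma integrable_stepGap (hm : 1 ≤ m) (hg : ∀ z, Measurable fun w => g w z)
    (hq0 : ∀ z, 0 ≤ q z) (hq1 : ∑ z, q z = 1)
    (hq0' : ∀ z, 0 ≤ q' z) (hq1' : ∑ z, q' z = 1) {B : ℝ} (hB : ∀ w z j, |g w z j| ≤ B)
    (μ : Measure (Fin d → ℝ)) [IsFiniteMeasure μ] : Integrable (stepGap d m σ g q q') μ := by
  refine Integrable.of_bound (measurable_stepGap hg).aestronglyMeasurable
    (√((∑ _j : Fin d, ((2 * B) ^ 2 + 2 * B ^ 2 / m)) / σ ^ 2) / 2) (.of_forall fun w => ?_)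
  rw [Real.norm_of_nonneg (stepGap_nonneg hq0 hq0' w)]
  refine (stepGap_le hm hq0 hq1 hq0' hq1' (hB w)).trans ?_
  gcongr ?_ / 2
  apply Real.sqrt_le_sqrt
  gcongr ?_ / _
  refine Finset.sum_le_sum fun j _ => ?_
  have mean : ∀ p : 𝒳 × ℤˣ → ℝ, (∀ z, 0 ≤ p z) → ∑ z, p z = 1 →
      |∑ z, p z * g w z j| ≤ B := fun p hp0 hp1 => by
    calc |∑ z, p z * g w z j| ≤ ∑ z, p z * B :=
          (Finset.abs_sum_le_sum_abs _ _).trans <| Finset.sum_le_sum fun z _ => by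
            rw [abs_mul, abs_of_nonneg (hp0 z)]
            exact mul_le_mul_of_nonneg_left (hB w z j) (hp0 z)
      _ = B := by rw [← Finset.sum_mul, hp1, one_mul]
  have h1 := abs_le.1 (mean q hq0 hq1)
  have h2 := abs_le.1 (mean q' hq0' hq1')
  gcongr ?_ + _
  exact sq_le_sq' (by linarith) (by linarith)

end Step

section Iterates

variable {𝒳 : Type*} [Fintype 𝒳] {d m T : ℕ} {σ : ℝ}
  {G : ℕ → (Fin d → ℝ) → 𝒳 × ℤˣ → Fin d → ℝ} {q q' : 𝒳 × ℤˣ → ℝ}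

lemma isProbabilityMeasure_iterLaw (hG : ∀ t, t < T → ∀ z, Measurable fun w => G t w z)
    (hq0 : ∀ z, 0 ≤ q z) (hq1 : ∑ z, q z = 1) (w₀ : Fin d → ℝ) {t : ℕ} (ht : t ≤ T) :
    IsProbabilityMeasure (iterLaw d m σ G q w₀ t) := by
  induction t with
  | zero => exact Measure.dirac.isProbabilityMeasure
  | succ t ih =>
    have := ih (by omega)
    change IsProbabilityMeasure ((iterLaw d m σ G q w₀ t).bind (stepLaw d m σ (G t) q))
    constructor
    rw [Measure.bind_apply MeasurableSet.univ (measurable_stepLaw (hG t (by omega)) q).aemeasurable]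
    have h1 : ∀ w, stepLaw d m σ (G t) q w Set.univ = 1 := fun w =>
      (isProbabilityMeasure_stepLaw hq0 hq1 w).measure_univ
    simp [h1]

/-- The one-step gaps add up along the trajectory. -/
lemma abs_integral_iterLaw_sub_le (hσ : 0 < σ) (hm : 1 ≤ m)
    (hG : ∀ t, t < T → ∀ z, Measurable fun w => G t w z) {B : ℝ}
    (hB : ∀ t, t < T → ∀ w z j, |G t w z j| ≤ B)
    (hq0 : ∀ z, 0 ≤ q z) (hq1 : ∑ z, q z = 1) (hq0' : ∀ z, 0 ≤ q' z) (hq1' : ∑ z, q' z = 1)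
    (w₀ : Fin d → ℝ) {t : ℕ} (ht : t ≤ T)
    {h : (Fin d → ℝ) → ℝ} (hh : Measurable h) (h0 : ∀ x, 0 ≤ h x) (h1 : ∀ x, h x ≤ 1) :
    |∫ x, h x ∂iterLaw d m σ G q w₀ t - ∫ x, h x ∂iterLaw d m σ G q' w₀ t| ≤
      ∑ r ∈ Finset.range t, ∫ w, stepGap d m σ (G r) q q' w ∂iterLaw d m σ G q' w₀ r := by
  induction t generalizing h with
  | zero => simp [iterLaw]
  | succ t ih =>
    have htT : t < T := by omega
    have hP := isProbabilityMeasure_iterLaw (m := m) (σ := σ) hG hq0 hq1 w₀ htT.le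
    have hQ := isProbabilityMeasure_iterLaw (m := m) (σ := σ) hG hq0' hq1' w₀ htT.le
    have hk : ∀ w, IsProbabilityMeasure (stepLaw d m σ (G t) q w) :=
      isProbabilityMeasure_stepLaw hq0 hq1
    have hk' : ∀ w, IsProbabilityMeasure (stepLaw d m σ (G t) q' w) :=
      isProbabilityMeasure_stepLaw hq0' hq1'
    obtain ⟨hKm, hK⟩ := integral_bind_of_mem_Icc (μ := iterLaw d m σ G q w₀ t)
      (measurable_stepLaw (hG t htT) q) hk hh h0 h1
    obtain ⟨hKm', hK'⟩ := integral_bind_of_mem_Icc (μ := iterLaw d m σ G q' w₀ t)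
      (measurable_stepLaw (hG t htT) q') hk' hh h0 h1
    have hle : ∀ ν : Measure (Fin d → ℝ), IsProbabilityMeasure ν → ∫ x, h x ∂ν ≤ 1 := by
      intro ν _
      have : Integrable h ν := Integrable.of_bound hh.aestronglyMeasurable 1
        (.of_forall fun x => by rw [Real.norm_of_nonneg (h0 x)]; exact h1 x)
      simpa using integral_mono this (integrable_const (1 : ℝ)) h1
    have hint : ∀ p : 𝒳 × ℤˣ → ℝ, (∀ w, IsProbabilityMeasure (stepLaw d m σ (G t) p w)) →
        Measurable (fun w => ∫ x, h x ∂stepLaw d m σ (G t) p w) →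
        Integrable (fun w => ∫ x, h x ∂stepLaw d m σ (G t) p w) (iterLaw d m σ G q' w₀ t) :=
      fun p hp hpm => Integrable.of_bound hpm.aestronglyMeasurable 1 (.of_forall fun w => by
        rw [Real.norm_of_nonneg (integral_nonneg h0)]; exact hle _ (hp w))
    change |∫ x, h x ∂(iterLaw d m σ G q w₀ t).bind (stepLaw d m σ (G t) q) -
      ∫ x, h x ∂(iterLaw d m σ G q' w₀ t).bind (stepLaw d m σ (G t) q')| ≤ _
    rw [hK, hK', Finset.sum_range_succ]
    refine (abs_sub_le _
      (∫ w, ∫ x, h x ∂stepLaw d m σ (G t) q w ∂iterLaw d m σ G q' w₀ t) _).trans ?_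
    refine add_le_add (ih htT.le hKm (fun w => integral_nonneg h0) fun w => hle _ (hk w)) ?_
    rw [← integral_sub (hint q hk hKm) (hint q' hk' hKm'), ← Real.norm_eq_abs]
    exact norm_integral_le_of_norm_le
      (integrable_stepGap hm (hG t htT) hq0 hq1 hq0' hq1' (hB t htT) _)
      (.of_forall fun w => abs_integral_stepLaw_sub_le hσ hq0 hq1 hq0' hq1' w hh h0 h1)

end Iterates

lemma tvDist_le_of_forall_integral {α : Type*} [MeasurableSpace α] {P Q : Measure α} {C : ℝ}
    (hC : ∀ h : α → ℝ, Measurable h → (∀ x, 0 ≤ h x) → (∀ x, h x ≤ 1) →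
      |∫ x, h x ∂P - ∫ x, h x ∂Q| ≤ C) : tvDist P Q ≤ C := by
  have : Nonempty {s : Set α // MeasurableSet s} := ⟨⟨∅, MeasurableSet.empty⟩⟩
  refine ciSup_le fun s => ?_
  have := hC (s.1.indicator 1) (measurable_one.indicator s.2)
    (fun x => Set.indicator_nonneg (fun _ _ => zero_le_one) x)
    (fun x => Set.indicator_le_self' (fun _ _ => zero_le_one) x)
  simpa [integral_indicator_one s.2, Measure.real] using this

section Weights

variable {𝒳 : Type*} {pX : 𝒳 → ℝ}

lemma label_weights_nonneg (hpX0 : ∀ x, 0 ≤ pX x) (F : 𝒳 → ℤˣ) (z : 𝒳 × ℤˣ) :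
    0 ≤ pX z.1 * if z.2 = F z.1 then 1 else 0 :=
  mul_nonneg (hpX0 _) (by split_ifs <;> norm_num)

lemma junk_weights_nonneg (hpX0 : ∀ x, 0 ≤ pX x) (z : 𝒳 × ℤˣ) : 0 ≤ pX z.1 * (1 / 2) :=
  mul_nonneg (hpX0 _) (by norm_num)

lemma sum_label_weights [Fintype 𝒳] (hpX1 : ∑ x, pX x = 1) (F : 𝒳 → ℤˣ) :
    ∑ z : 𝒳 × ℤˣ, (pX z.1 * if z.2 = F z.1 then 1 else 0) = 1 := by
  have := sum_label_weights_mul pX F fun _ => 1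
  simp only [mul_one] at this
  rw [this, hpX1]

lemma sum_junk_weights [Fintype 𝒳] (hpX1 : ∑ x, pX x = 1) :
    ∑ z : 𝒳 × ℤˣ, pX z.1 * (1 / 2) = 1 := by
  have := sum_junk_weights_mul pX fun _ => 1
  norm_num at this ⊢
  rw [this, hpX1]

end Weights

lemma sum_mul_sum_add_div {α κ : Type*} [Fintype α] [Fintype κ] {p : α → ℝ}
    (hp : ∑ a, p a = 1) (X : α → κ → ℝ) (c s : ℝ) :
    ∑ a, p a * ((∑ j, (X a j + c)) / s) = (∑ j, (∑ a, p a * X a j + c)) / s := by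
  have h : ∀ j, ∑ a, p a * X a j + c = ∑ a, p a * (X a j + c) := fun j => by
    simp_rw [mul_add]
    rw [Finset.sum_add_distrib, ← Finset.sum_mul, hp, one_mul]
  simp_rw [h, ← mul_div_assoc, ← Finset.sum_div, Finset.mul_sum]
  rw [Finset.sum_comm]

lemma sum_mul_stepGap_le {𝒳 : Type*} [Fintype 𝒳] [DecidableEq 𝒳] {pX : 𝒳 → ℝ}
    (hpX0 : ∀ x, 0 ≤ pX x) (hpX1 : ∑ x : 𝒳, pX x = 1)
    {pF : (𝒳 → ℤˣ) → ℝ} (hpF0 : ∀ F, 0 ≤ pF F) (hpF1 : ∑ F : 𝒳 → ℤˣ, pF F = 1)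
    {d m : ℕ} (hm : 1 ≤ m) {σ B : ℝ} {g : (Fin d → ℝ) → 𝒳 × ℤˣ → Fin d → ℝ} {w : Fin d → ℝ}
    (hB : ∀ z j, |g w z j| ≤ B) :
    ∑ F, pF F * stepGap d m σ g (fun z => pX z.1 * if z.2 = F z.1 then 1 else 0)
      (fun z => pX z.1 * (1 / 2)) w ≤ √(d * (B ^ 2 * (√(cp pX pF) + 2 / m)) / σ ^ 2) / 2 := by
  set q : (𝒳 → ℤˣ) → 𝒳 × ℤˣ → ℝ := fun F z => pX z.1 * if z.2 = F z.1 then 1 else 0 with hq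
  set q' : 𝒳 × ℤˣ → ℝ := fun z => pX z.1 * (1 / 2) with hq'
  have hD : ∀ F, 0 ≤ (∑ j, ((∑ z, q F z * g w z j - ∑ z, q' z * g w z j) ^ 2 +
      2 * B ^ 2 / m)) / σ ^ 2 := fun F => by positivity
  calc ∑ F, pF F * stepGap d m σ g (q F) q' w
      ≤ ∑ F, pF F * (√((∑ j, ((∑ z, q F z * g w z j - ∑ z, q' z * g w z j) ^ 2 +
          2 * B ^ 2 / m)) / σ ^ 2) / 2) :=
        Finset.sum_le_sum fun F _ => mul_le_mul_of_nonneg_left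
          (stepGap_le hm (label_weights_nonneg hpX0 F) (sum_label_weights hpX1 F)
            (junk_weights_nonneg hpX0) (sum_junk_weights hpX1) hB) (hpF0 F)
    _ = (∑ F, pF F * √((∑ j, ((∑ z, q F z * g w z j - ∑ z, q' z * g w z j) ^ 2 +
          2 * B ^ 2 / m)) / σ ^ 2)) / 2 := by
        simp_rw [← mul_div_assoc, ← Finset.sum_div]
    _ ≤ √(∑ F, pF F * ((∑ j, ((∑ z, q F z * g w z j - ∑ z, q' z * g w z j) ^ 2 +
          2 * B ^ 2 / m)) / σ ^ 2)) / 2 :=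
        div_le_div_of_nonneg_right (sum_mul_sqrt_le hpF0 hpF1 hD) zero_le_two
    _ = √((∑ j, (∑ F, pF F * (∑ z, q F z * g w z j - ∑ z, q' z * g w z j) ^ 2 +
          2 * B ^ 2 / m)) / σ ^ 2) / 2 := by
        rw [sum_mul_sum_add_div hpF1]
    _ ≤ √((∑ _j : Fin d, (B ^ 2 * √(cp pX pF) + 2 * B ^ 2 / m)) / σ ^ 2) / 2 := by
        refine div_le_div_of_nonneg_right (Real.sqrt_le_sqrt ?_) zero_le_two
        refine div_le_div_of_nonneg_right (Finset.sum_le_sum fun j _ => ?_) (sq_nonneg σ)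
        exact add_le_add_left
          (sum_mul_label_mean_sub_junk_mean_sq_le hpX0 hpX1 fun z => hB z j) _
    _ = √(d * (B ^ 2 * (√(cp pX pF) + 2 / m)) / σ ^ 2) / 2 := by
        simp only [Finset.sum_const, Finset.card_univ, Fintype.card_fin, nsmul_eq_mul]
        congr 4
        ring

lemma sqrt_sqrt_add_div_two_le {c : ℝ} (hc0 : 0 ≤ c) (hc1 : c ≤ 1) {m : ℕ} (hm : 1 ≤ m) :
    √(√c + 2 / m) / 2 ≤ (1 / m + (1 - 1 / (m : ℝ)) * c) ^ ((1 : ℝ) / 4) := by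
  have hm' : (1 : ℝ) ≤ m := by exact_mod_cast hm
  set i : ℝ := 1 / m with hi
  have hi0 : 0 ≤ i := by positivity
  have hi1 : i ≤ 1 := by rw [hi, div_le_one (by linarith)]; exact hm'
  set K : ℝ := i + (1 - i) * c with hK
  have hcK : c ≤ K := by nlinarith
  have hiK : i ≤ K := by nlinarith [mul_nonneg (sub_nonneg.2 hi1) hc0]
  have hK0 : 0 ≤ K := hi0.trans hiK
  have hroot : K ^ ((1 : ℝ) / 4) = √√K := by
    rw [Real.sqrt_eq_rpow, Real.sqrt_eq_rpow, ← Real.rpow_mul hK0]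
    norm_num
  have h1 : √c ≤ √K := Real.sqrt_le_sqrt hcK
  have h2 : i ≤ √K := (Real.le_sqrt_of_sq_le (by nlinarith)).trans (Real.sqrt_le_sqrt hiK)
  have h3 : (2 : ℝ) / m = 2 * i := by rw [hi]; ring
  rw [hroot, h3, div_le_iff₀ two_pos]
  calc √(√c + 2 * i) ≤ √(√K * 2 ^ 2) := Real.sqrt_le_sqrt (by linarith [Real.sqrt_nonneg K])
    _ = √√K * 2 := by rw [Real.sqrt_mul (Real.sqrt_nonneg K), Real.sqrt_sq zero_le_two]

/-- noisy GD with batches cannot distinguish a low cross-predictability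
function distribution from junk labels. With `W_F` the iterates driven by labels `F` and
`W_⋆` the iterates driven by uniformly random labels,
`E_F[d_TV(Law(W_F^{(T)}|F), Law(W_⋆^{(T)}))]
  ≤ (γA√d·T/σ)·(1/m + (1 − 1/m)·CP(P_𝒳,P_ℱ))^{1/4}`. -/
theorem noisy_gd_junk_indistinguishable {𝒳 : Type*} [Fintype 𝒳] [DecidableEq 𝒳] [Nonempty 𝒳]
    (pX : 𝒳 → ℝ) (hpX0 : ∀ x, 0 ≤ pX x) (hpX1 : ∑ x : 𝒳, pX x = 1)
    (pF : (𝒳 → ℤˣ) → ℝ) (hpF0 : ∀ F, 0 ≤ pF F) (hpF1 : ∑ F : 𝒳 → ℤˣ, pF F = 1)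
    (d T m : ℕ) (hd : 1 ≤ d) (hT : 1 ≤ T) (hm : 1 ≤ m)
    (γ A σ : ℝ) (hγ : 0 < γ) (hA : 0 < A) (hσ : 0 < σ)
    (G : ℕ → (Fin d → ℝ) → 𝒳 × ℤˣ → Fin d → ℝ)
    (hGmeas : ∀ t, t < T → ∀ z, Measurable fun w => G t w z)
    (hGbd : ∀ t, t < T → ∀ w z j, |G t w z j| ≤ γ * A)
    (w₀ : Fin d → ℝ) :
    ∑ F : 𝒳 → ℤˣ, pF F *
        tvDist
          (iterLaw d m σ G (fun z => pX z.1 * if z.2 = F z.1 then 1 else 0) w₀ T)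
          (iterLaw d m σ G (fun z => pX z.1 * (1 / 2)) w₀ T)
      ≤ γ * A * Real.sqrt d * T / σ *
          (1 / m + (1 - 1 / (m : ℝ)) * cp pX pF) ^ ((1 : ℝ) / 4) := by
  set q : (𝒳 → ℤˣ) → 𝒳 × ℤˣ → ℝ := fun F z => pX z.1 * if z.2 = F z.1 then 1 else 0 with hq
  set q' : 𝒳 × ℤˣ → ℝ := fun z => pX z.1 * (1 / 2) with hq'
  have hq0 : ∀ F z, 0 ≤ q F z := label_weights_nonneg hpX0
  have hq1 : ∀ F, ∑ z, q F z = 1 := sum_label_weights hpX1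
  have hq0' : ∀ z, 0 ≤ q' z := junk_weights_nonneg hpX0
  have hq1' : ∑ z, q' z = 1 := sum_junk_weights hpX1
  set C : ℝ := √(d * ((γ * A) ^ 2 * (√(cp pX pF) + 2 / m)) / σ ^ 2) / 2 with hC
  have hgap : ∀ r < T, ∑ F, pF F * ∫ w, stepGap d m σ (G r) (q F) q' w ∂iterLaw d m σ G q' w₀ r ≤
      C := by
    intro r hr
    have hQ := isProbabilityMeasure_iterLaw (m := m) (σ := σ) hGmeas hq0' hq1' w₀ hr.le
    have hint : ∀ F, Integrable (fun w => pF F * stepGap d m σ (G r) (q F) q' w)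
        (iterLaw d m σ G q' w₀ r) := fun F =>
      (integrable_stepGap hm (hGmeas r hr) (hq0 F) (hq1 F) hq0' hq1' (hGbd r hr) _).const_mul _
    simp_rw [← integral_const_mul]
    rw [← integral_finsetSum _ fun F _ => hint F]
    have := integral_mono (integrable_finsetSum univ fun F _ => hint F)
      (integrable_const (μ := iterLaw d m σ G q' w₀ r) C)
      fun w => sum_mul_stepGap_le (σ := σ) hpX0 hpX1 hpF0 hpF1 hm (hGbd r hr w)
    simpa using this
  calc ∑ F, pF F * tvDist (iterLaw d m σ G (q F) w₀ T) (iterLaw d m σ G q' w₀ T)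
      ≤ ∑ F, pF F * ∑ r ∈ Finset.range T,
          ∫ w, stepGap d m σ (G r) (q F) q' w ∂iterLaw d m σ G q' w₀ r :=
        Finset.sum_le_sum fun F _ => mul_le_mul_of_nonneg_left
          (tvDist_le_of_forall_integral fun h hh h0 h1 =>
            abs_integral_iterLaw_sub_le hσ hm hGmeas hGbd (hq0 F) (hq1 F) hq0' hq1' w₀ le_rfl
              hh h0 h1) (hpF0 F)
    _ = ∑ r ∈ Finset.range T,
          ∑ F, pF F * ∫ w, stepGap d m σ (G r) (q F) q' w ∂iterLaw d m σ G q' w₀ r := by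
        simp_rw [Finset.mul_sum]
        exact Finset.sum_comm
    _ ≤ ∑ _r ∈ Finset.range T, C :=
        Finset.sum_le_sum fun r hr => hgap r (Finset.mem_range.1 hr)
    _ = γ * A * √d * T / σ * (√(√(cp pX pF) + 2 / m) / 2) := by
        have hs : √(d * ((γ * A) ^ 2 * (√(cp pX pF) + 2 / m)) / σ ^ 2) =
            √d * (γ * A * √(√(cp pX pF) + 2 / m)) / σ := by
          rw [Real.sqrt_div' _ (sq_nonneg σ), Real.sqrt_sq hσ.le, Real.sqrt_mul (Nat.cast_nonneg d),
            Real.sqrt_mul (sq_nonneg _), Real.sqrt_sq (by positivity)]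
        rw [Finset.sum_const, Finset.card_range, nsmul_eq_mul, hC, hs]
        ring
    _ ≤ _ := mul_le_mul_of_nonneg_left
        (sqrt_sqrt_add_div_two_le (cp_nonneg hpX0) (cp_le_one hpX0 hpX1 hpF0 hpF1) hm)
        (by positivity)
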